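/- arXiv:1712.05065 — 4 statements merged into one kernel-verified Lean document; each statement's English description precedes it below -/
import Mathlib

section
/- With the setup below, for every n×n real matrix γ and all indices 1 ≤ i, j ≤ n, the (i,j) entry of z⁻¹ γ z equals (z⁻¹ γ z)_{ij} = Y_{ij} · Σ_{r=i}^{n} Σ_{s=1}^{j} c_{rs}^{(ij)} γ_{rs}, where c_{rs}^{(ij)} := (x⁻¹)_{ir} · x_{sj}. Moreover c_{ij}^{(ij)} = 1 and |c_{rs}^{(ij)}| ≤ 2^n for all i ≤ r ≤ n and 1 ≤ s ≤ j. -/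
open Matrix

/-- The diagonal Iwasawa coordinates: `t k = y 1 * y 2 * ⋯ * y (n - k)` for the `k`-th
(1-based) diagonal entry; here `k : Fin n` is 0-based, so `t k = ∏_{l=1}^{n-1-k} y l`. -/
noncomputable def tvec (n : ℕ) (y : ℕ → ℝ) : Fin n → ℝ :=
  fun k => ∏ l ∈ Finset.Icc 1 (n - 1 - (k : ℕ)), y l

/-- `Y i j = t j / t i`. -/
noncomputable def Ymat (n : ℕ) (y : ℕ → ℝ) (i j : Fin n) : ℝ := tvec n y j / tvec n y i

/-- `z = x * y` with `y` the diagonal matrix with entries `t k`. -/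
noncomputable def zmat (n : ℕ) (x : Matrix (Fin n) (Fin n) ℝ) (y : ℕ → ℝ) :
    Matrix (Fin n) (Fin n) ℝ :=
  x * Matrix.diagonal (tvec n y)

theorem tvec_pos {n : ℕ} {y : ℕ → ℝ} (hy : ∀ l, 1 ≤ l → l ≤ n - 1 → 0 < y l) (k : Fin n) :
    0 < tvec n y k := by
  refine Finset.prod_pos fun l hl => ?_
  rw [Finset.mem_Icc] at hl
  exact hy l hl.1 (by omega)

theorem det_eq_one_of_upper_unitriangular {n : ℕ} {x : Matrix (Fin n) (Fin n) ℝ}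
    (hdiag : ∀ i, x i i = 1) (hlow : ∀ i j : Fin n, j < i → x i j = 0) : x.det = 1 := by
  rw [Matrix.det_of_isUpperTriangular (fun i j h => hlow i j h)]
  simp [hdiag]

/-- The inverse of an upper unitriangular matrix is upper triangular. -/
theorem inv_apply_eq_zero_of_lt {n : ℕ} {x : Matrix (Fin n) (Fin n) ℝ}
    (hdiag : ∀ i, x i i = 1) (hlow : ∀ i j : Fin n, j < i → x i j = 0)
    {i j : Fin n} (hij : j < i) : x⁻¹ i j = 0 := by
  have hdet := det_eq_one_of_upper_unitriangular hdiag hlow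
  have : Invertible x := x.invertibleOfIsUnitDet (by simp [hdet])
  have hx : x.BlockTriangular id := fun i j h => hlow i j h
  exact Matrix.blockTriangular_inv_of_blockTriangular hx hij

/-- Column recursion for the inverse of an upper unitriangular matrix. -/
theorem inv_apply_eq_sub_sum {n : ℕ} {x : Matrix (Fin n) (Fin n) ℝ}
    (hdiag : ∀ i, x i i = 1) (hlow : ∀ i j : Fin n, j < i → x i j = 0) (i j : Fin n) :
    x⁻¹ i j = (1 : Matrix (Fin n) (Fin n) ℝ) i j - ∑ k ∈ Finset.Iio j, x⁻¹ i k * x k j := by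
  have hdet := det_eq_one_of_upper_unitriangular hdiag hlow
  have h : (x⁻¹ * x) i j = (1 : Matrix (Fin n) (Fin n) ℝ) i j := by
    rw [Matrix.nonsing_inv_mul x (by simp [hdet])]
  have hsub : ∑ k ∈ Finset.Iic j, x⁻¹ i k * x k j = ∑ k, x⁻¹ i k * x k j := by
    refine Finset.sum_subset (Finset.subset_univ _) fun k _ hk => ?_
    rw [hlow k j (by simpa using hk), mul_zero]
  rw [Matrix.mul_apply, ← hsub, ← Finset.Iio_insert, Finset.sum_insert (by simp), hdiag] at h
  linarith

theorem inv_apply_self_eq_one {n : ℕ} {x : Matrix (Fin n) (Fin n) ℝ}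
    (hdiag : ∀ i, x i i = 1) (hlow : ∀ i j : Fin n, j < i → x i j = 0) (i : Fin n) :
    x⁻¹ i i = 1 := by
  rw [inv_apply_eq_sub_sum hdiag hlow, Matrix.one_apply_eq, Finset.sum_eq_zero, sub_zero]
  intro k hk
  rw [inv_apply_eq_zero_of_lt hdiag hlow (Finset.mem_Iio.mp hk), zero_mul]

theorem sum_Iio_two_pow {n : ℕ} (j : Fin n) :
    ∑ k ∈ Finset.Iio j, (2 : ℝ) ^ (k : ℕ) = 2 ^ (j : ℕ) - 1 := by
  have h : ∑ k ∈ Finset.Iio j, (2 : ℝ) ^ (k : ℕ) = ∑ k ∈ Finset.range j, (2 : ℝ) ^ k := by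
    rw [← Nat.Iio_eq_range, ← Fin.map_valEmbedding_Iio, Finset.sum_map]
    rfl
  rw [h, geom_sum_eq (by norm_num)]
  norm_num

theorem abs_inv_apply_le_two_pow {n : ℕ} {x : Matrix (Fin n) (Fin n) ℝ}
    (hdiag : ∀ i, x i i = 1) (hlow : ∀ i j : Fin n, j < i → x i j = 0)
    (hbd : ∀ i j : Fin n, i < j → |x i j| ≤ 1 / 2) (i j : Fin n) :
    |x⁻¹ i j| ≤ 2 ^ (j : ℕ) := by
  induction j using WellFoundedLT.induction with
  | ind j ih =>
    have hone : |(1 : Matrix (Fin n) (Fin n) ℝ) i j| ≤ 1 := by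
      rw [Matrix.one_apply]
      split_ifs <;> simp
    have hsum : |∑ k ∈ Finset.Iio j, x⁻¹ i k * x k j| ≤ (2 ^ (j : ℕ) - 1) * (1 / 2) := by
      rw [← sum_Iio_two_pow, Finset.sum_mul]
      refine (Finset.abs_sum_le_sum_abs _ _).trans (Finset.sum_le_sum fun k hk => ?_)
      have hk' := Finset.mem_Iio.mp hk
      rw [abs_mul]
      exact mul_le_mul (ih k hk') (hbd k j hk') (abs_nonneg _) (by positivity)
    have hpow : (1 : ℝ) ≤ 2 ^ (j : ℕ) := one_le_pow₀ (by norm_num)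
    rw [inv_apply_eq_sub_sum hdiag hlow]
    linarith [abs_sub ((1 : Matrix (Fin n) (Fin n) ℝ) i j)
      (∑ k ∈ Finset.Iio j, x⁻¹ i k * x k j)]

theorem zmat_inv {n : ℕ} {x : Matrix (Fin n) (Fin n) ℝ} {y : ℕ → ℝ} (hx : IsUnit x.det)
    (ht : ∀ k, tvec n y k ≠ 0) :
    (zmat n x y)⁻¹ = Matrix.diagonal (fun k => (tvec n y k)⁻¹) * x⁻¹ := by
  apply Matrix.inv_eq_left_inv
  rw [zmat, Matrix.mul_assoc, ← Matrix.mul_assoc x⁻¹, Matrix.nonsing_inv_mul x hx,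
    Matrix.one_mul, Matrix.diagonal_mul_diagonal]
  simp [ht]

/-- With `x` upper triangular unipotent with strictly-upper entries bounded by `1/2`,
`y 1, …, y (n-1) > 0`, and `z = x y`: for every `n × n` real matrix `γ` and all `i, j`,
`(z⁻¹ γ z) i j = Y i j * ∑_{r ≥ i} ∑_{s ≤ j} c r s * γ r s` with `c r s = x⁻¹ i r * x s j`;
moreover `c i j = 1` and `|c r s| ≤ 2 ^ n` for all `r ≥ i`, `s ≤ j`. -/
theorem stmt_2 (n : ℕ) (hn : 2 ≤ n) (x : Matrix (Fin n) (Fin n) ℝ)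
    (hdiag : ∀ i, x i i = 1) (hlow : ∀ i j : Fin n, j < i → x i j = 0)
    (hbd : ∀ i j : Fin n, i < j → |x i j| ≤ 1 / 2)
    (y : ℕ → ℝ) (hy : ∀ l, 1 ≤ l → l ≤ n - 1 → 0 < y l)
    (γ : Matrix (Fin n) (Fin n) ℝ) (i j : Fin n) :
    ((zmat n x y)⁻¹ * γ * zmat n x y) i j =
        Ymat n y i j * ∑ r ∈ Finset.Ici i, ∑ s ∈ Finset.Iic j, (x⁻¹ i r * x s j) * γ r s ∧
      x⁻¹ i i * x j j = 1 ∧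
      ∀ r ∈ Finset.Ici i, ∀ s ∈ Finset.Iic j, |x⁻¹ i r * x s j| ≤ 2 ^ n := by
  have hdet := det_eq_one_of_upper_unitriangular hdiag hlow
  refine ⟨?_, ?_, fun r _ s _ => ?_⟩
  · have hz : (zmat n x y)⁻¹ * γ * zmat n x y =
        Matrix.diagonal (fun k => (tvec n y k)⁻¹) * (x⁻¹ * γ * x) *
          Matrix.diagonal (tvec n y) := by
      rw [zmat_inv (by simp [hdet]) fun k => (tvec_pos hy k).ne', zmat]
      simp only [Matrix.mul_assoc]
    have hr : ∑ r ∈ Finset.Ici i, ∑ s ∈ Finset.Iic j, (x⁻¹ i r * x s j) * γ r s =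
        ∑ r, ∑ s ∈ Finset.Iic j, (x⁻¹ i r * x s j) * γ r s := by
      refine Finset.sum_subset (Finset.subset_univ _) fun r _ h => ?_
      rw [inv_apply_eq_zero_of_lt hdiag hlow (by simpa using h)]
      simp
    have hs (r : Fin n) : ∑ s ∈ Finset.Iic j, (x⁻¹ i r * x s j) * γ r s =
        ∑ s, (x⁻¹ i r * x s j) * γ r s := by
      refine Finset.sum_subset (Finset.subset_univ _) fun s _ h => ?_
      rw [hlow s j (by simpa using h)]
      simp
    have hc : (x⁻¹ * γ * x) i j = ∑ r, ∑ s, (x⁻¹ i r * x s j) * γ r s := by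
      simp only [Matrix.mul_apply, Finset.sum_mul]
      rw [Finset.sum_comm]
      exact Finset.sum_congr rfl fun r _ => Finset.sum_congr rfl fun s _ => by ring
    rw [hz, Matrix.mul_diagonal, Matrix.diagonal_mul, hr, Finset.sum_congr rfl fun r _ => hs r,
      ← hc, Ymat]
    ring
  · rw [inv_apply_self_eq_one hdiag hlow, hdiag, one_mul]
  · have hx : |x s j| ≤ 1 := by
      rcases lt_trichotomy s j with h | rfl | h
      · exact (hbd s j h).trans (by norm_num)
      · simp [hdiag]
      · simp [hlow s j h]
    rw [abs_mul]
    calc |x⁻¹ i r| * |x s j| ≤ 2 ^ (r : ℕ) * 1 :=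
          mul_le_mul (abs_inv_apply_le_two_pow hdiag hlow hbd i r) hx (abs_nonneg _)
            (by positivity)
      _ ≤ 2 ^ n := by
          rw [mul_one]
          exact pow_le_pow_right₀ (by norm_num) r.isLt.le
end

section
/- Let n ≥ 1 be an integer and let x be an n×n real matrix that is upper triangular with unit diagonal (x_{ii} = 1 for all i, x_{ij} = 0 for i > j) and with |x_{ij}| ≤ 1/2 for all j > i. Then x is invertible, its inverse x⁻¹ is upper triangular with unit diagonal ((x⁻¹)_{ii} = 1 and (x⁻¹)_{ij} = 0 for i > j), and |(x⁻¹)_{ij}| ≤ (1/2)·(3/2)^{j−i−1} for all j > i. -/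
open Matrix

/-- A sequence supported on `[i, ∞)` with value `1` at `i`, each of whose later terms is at most
half the sum of its predecessors, has partial sums growing at most like powers of `3 / 2`. -/
theorem sum_range_le_three_halves_pow {f : ℕ → ℝ} {i : ℕ} (hlt : ∀ k < i, f k = 0)
    (hi : f i = 1) (hf : ∀ j, i < j → f j ≤ 1 / 2 * ∑ k ∈ Finset.range j, f k) (d : ℕ) :
    ∑ k ∈ Finset.range (i + 1 + d), f k ≤ (3 / 2) ^ d := by
  induction d with
  | zero =>
    have hz : ∑ k ∈ Finset.range i, f k = 0 :=
      Finset.sum_eq_zero fun k hk => hlt k (Finset.mem_range.mp hk)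
    simp [Finset.sum_range_succ, hz, hi]
  | succ d ih =>
    rw [← add_assoc, Finset.sum_range_succ, pow_succ]
    linarith [hf (i + 1 + d) (by lia)]

/-- If `x` is an `n × n` real upper triangular matrix with unit diagonal and all
strictly-upper entries of absolute value at most `1/2`, then `x` is invertible, `x⁻¹` is
upper triangular with unit diagonal, and `|x⁻¹ i j| ≤ (1/2)·(3/2)^(j-i-1)` for `i < j`. -/
theorem stmt_3 (n : ℕ) (hn : 1 ≤ n) (x : Matrix (Fin n) (Fin n) ℝ)
    (hdiag : ∀ i, x i i = 1) (hlow : ∀ i j : Fin n, j < i → x i j = 0)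
    (hbd : ∀ i j : Fin n, i < j → |x i j| ≤ 1 / 2) :
    IsUnit x ∧ (∀ i, x⁻¹ i i = 1) ∧ (∀ i j : Fin n, j < i → x⁻¹ i j = 0) ∧
      ∀ i j : Fin n, i < j →
        |x⁻¹ i j| ≤ (1 / 2) * (3 / 2 : ℝ) ^ ((j : ℕ) - (i : ℕ) - 1) := by
  have hx : x.BlockTriangular id := fun i j hij => hlow i j hij
  have hdet : x.det = 1 := by rw [det_of_isUpperTriangular hx]; simp [hdiag]
  have hunit : IsUnit x.det := by simp [hdet]
  let _ : Invertible x := x.invertibleOfIsUnitDet hunit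
  have hylow : ∀ i j : Fin n, j < i → x⁻¹ i j = 0 := fun i j hij =>
    blockTriangular_inv_of_blockTriangular hx hij
  have hyx : ∀ i j, ∑ k, x⁻¹ i k * x k j = (1 : Matrix (Fin n) (Fin n) ℝ) i j := fun i j => by
    rw [← Matrix.nonsing_inv_mul x hunit, mul_apply]
  have hydiag : ∀ i, x⁻¹ i i = 1 := fun i => by
    have h := hyx i i
    rw [Finset.sum_eq_single i, hdiag, one_apply_eq, mul_one] at h
    · exact h
    · intro k _ hk
      rcases lt_or_gt_of_ne hk with hk | hk
      · rw [hylow i k hk, zero_mul]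
      · rw [hlow k i hk, mul_zero]
    · simp
  refine ⟨(isUnit_iff_isUnit_det x).mpr hunit, hydiag, hylow, fun i j hij => ?_⟩
  set f : ℕ → ℝ := fun k => if h : k < n then |x⁻¹ i ⟨k, h⟩| else 0 with hf
  have hfval : ∀ k : Fin n, f k = |x⁻¹ i k| := fun k => by simp [hf]
  have hfnonneg : ∀ k, 0 ≤ f k := fun k => by
    simp only [hf]
    split_ifs <;> positivity
  have hentry : ∀ j : Fin n, i < j → f j ≤ 1 / 2 * ∑ k ∈ Finset.range j, f k := by
    intro j hij
    have h := hyx i j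
    rw [one_apply_ne hij.ne, ← Finset.add_sum_erase _ _ (Finset.mem_univ j), hdiag, mul_one] at h
    have hrange : ∑ k ∈ Finset.range j, f k = ∑ k : Fin n, if k < j then f k else 0 := by
      rw [← Finset.sum_filter]
      refine (Finset.sum_bij (fun (k : Fin n) _ => (k : ℕ)) ?_ ?_ ?_ ?_).symm
      · simp
      · exact fun a _ b _ hab => Fin.ext hab
      · intro k hk
        have hk' := Finset.mem_range.mp hk
        exact ⟨⟨k, hk'.trans j.isLt⟩, Finset.mem_filter.mpr ⟨Finset.mem_univ _, hk'⟩, rfl⟩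
      · simp
    rw [hfval, eq_neg_of_add_eq_zero_left h, abs_neg, hrange, Finset.mul_sum]
    calc |∑ k ∈ Finset.univ.erase j, x⁻¹ i k * x k j|
        ≤ ∑ k ∈ Finset.univ.erase j, |x⁻¹ i k * x k j| := Finset.abs_sum_le_sum_abs _ _
      _ ≤ ∑ k ∈ Finset.univ.erase j, 1 / 2 * (if k < j then f k else 0) := by
        refine Finset.sum_le_sum fun k hk => ?_
        rcases lt_or_gt_of_ne (Finset.ne_of_mem_erase hk) with hkj | hkj
        · rw [if_pos hkj, hfval, abs_mul, mul_comm]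
          exact mul_le_mul_of_nonneg_right (hbd k j hkj) (abs_nonneg _)
        · rw [hlow k j hkj, if_neg hkj.not_gt, mul_zero, abs_zero, mul_zero]
      _ ≤ ∑ k, 1 / 2 * (if k < j then f k else 0) :=
        Finset.sum_le_sum_of_subset_of_nonneg (Finset.erase_subset _ _) fun k _ _ => by
          have := hfnonneg k
          split_ifs <;> positivity
  have hrec : ∀ j, (i : ℕ) < j → f j ≤ 1 / 2 * ∑ k ∈ Finset.range j, f k := by
    intro j hij
    by_cases hj : j < n
    · exact hentry ⟨j, hj⟩ hij
    · have hzero : f j = 0 := dif_neg hj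
      have := Finset.sum_nonneg fun k (_ : k ∈ Finset.range j) => hfnonneg k
      rw [hzero]
      positivity
  have hsum := sum_range_le_three_halves_pow (i := i)
    (fun k hk => by
      have := hfval ⟨k, hk.trans i.isLt⟩
      rwa [hylow i _ hk, abs_zero] at this)
    (by rw [hfval, hydiag, abs_one]) hrec ((j : ℕ) - i - 1)
  rw [show (i : ℕ) + 1 + (j - i - 1) = j by lia] at hsum
  rw [← hfval]
  linarith [hrec j hij]
end

section
/- With the setup below, assume in addition y_l ≥ √3/2 for all 1 ≤ l ≤ n−1. For every A > 0 there exists a constant C > 0 depending only on n and A such that: if γ is an n×n matrix with integer entries satisfying |(z⁻¹ γ z)_{ij}| ≤ A for all 1 ≤ i, j ≤ n, and if for some 1 ≤ m ≤ n−1 there exist indices i ≥ n−m+1 and j ≤ n−m with γ_{ij} ≠ 0 (i.e., γ has a nonzero entry in its lower-left m×(n−m) block), then y_m ≤ C. -/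
open Matrix

theorem isUnit_det_zmat {n : ℕ} {x : Matrix (Fin n) (Fin n) ℝ} {y : ℕ → ℝ}
    (hdiag : ∀ i, x i i = 1) (hlower : ∀ i j : Fin n, j < i → x i j = 0)
    (hy : ∀ l, 1 ≤ l → l ≤ n - 1 → 0 < y l) : IsUnit (zmat n x y).det := by
  have hx : x.det = 1 := by
    rw [Matrix.det_of_isUpperTriangular (M := x) fun i j h => hlower i j h]
    simp [hdiag]
  rw [zmat, Matrix.det_mul, hx, one_mul, Matrix.det_diagonal, isUnit_iff_ne_zero]
  exact (Finset.prod_pos fun k _ => tvec_pos hy k).ne'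

/-- If every `y l` is at least `1 / 2` and the product defining `t j` has the factor `y m` while
the one defining `t a` does not, then `t a / t j` is at most `2 ^ n / y m`. -/
theorem tvec_mul_le {n m : ℕ} {y : ℕ → ℝ} (hy : ∀ l, 1 ≤ l → l ≤ n - 1 → 1 / 2 ≤ y l)
    {a j : Fin n} (hm : 1 ≤ m) (ha : n - m ≤ (a : ℕ)) (hj : (j : ℕ) + 1 ≤ n - m) :
    tvec n y a * y m ≤ 2 ^ n * tvec n y j := by
  have hpos : ∀ l, 1 ≤ l → l ≤ n - 1 → 0 < y l := fun l h₁ h₂ => by linarith [hy l h₁ h₂]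
  have hsub : Finset.Icc 1 (n - 1 - (a : ℕ)) ⊆ Finset.Icc 1 (n - 1 - (j : ℕ)) :=
    Finset.Icc_subset_Icc_right (by lia)
  set s := Finset.Icc 1 (n - 1 - (j : ℕ)) \ Finset.Icc 1 (n - 1 - (a : ℕ)) with hs
  have hms : m ∈ s := by
    simp only [hs, Finset.mem_sdiff, Finset.mem_Icc]
    lia
  have hsplit : tvec n y j = (y m * ∏ l ∈ s.erase m, y l) * tvec n y a := by
    rw [Finset.mul_prod_erase s y hms]
    exact (Finset.prod_sdiff hsub).symm
  have hcard : (s.erase m).card ≤ n := by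
    refine (Finset.card_le_card (Finset.erase_subset m s)).trans ?_
    refine (Finset.card_le_card Finset.sdiff_subset).trans ?_
    rw [Nat.card_Icc]
    lia
  have hprod : (1 / 2 : ℝ) ^ n ≤ ∏ l ∈ s.erase m, y l := by
    calc (1 / 2 : ℝ) ^ n ≤ (1 / 2) ^ (s.erase m).card :=
          pow_le_pow_of_le_one (by norm_num) (by norm_num) hcard
      _ = ∏ _l ∈ s.erase m, (1 / 2 : ℝ) := by rw [Finset.prod_const]
      _ ≤ ∏ l ∈ s.erase m, y l := by
          refine Finset.prod_le_prod (fun _ _ => by norm_num) fun l hl => ?_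
          have hl' := (Finset.mem_sdiff.mp (Finset.mem_of_mem_erase hl)).1
          rw [Finset.mem_Icc] at hl'
          exact hy l hl'.1 (by lia)
  have hta := tvec_pos hpos a
  have hym := hpos m hm (by lia)
  calc tvec n y a * y m = 2 ^ n * ((y m * (1 / 2) ^ n) * tvec n y a) := by
        rw [one_div, inv_pow]
        field_simp
    _ ≤ 2 ^ n * tvec n y j := by
        rw [hsplit]
        gcongr

/-- In a column `j` where row `i` of `γ` has its first nonzero entry, multiplying on the right by
a unipotent upper triangular matrix does not change the entry at `(i, j)`. -/
theorem mul_apply_of_unipotent {n : ℕ} {x γ : Matrix (Fin n) (Fin n) ℝ}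
    (hdiag : ∀ i, x i i = 1) (hlower : ∀ i j : Fin n, j < i → x i j = 0)
    {i j : Fin n} (hγ : ∀ k < j, γ i k = 0) : (γ * x) i j = γ i j := by
  rw [Matrix.mul_apply, Finset.sum_eq_single j, hdiag, mul_one]
  · intro k _ hk
    rcases lt_or_gt_of_ne hk with h | h
    · rw [hγ k h, zero_mul]
    · rw [hlower k j h, mul_zero]
  · simp

/-- With the Siegel-domain conditions `y l ≥ √3/2`: for every `A > 0` there is `C > 0`
depending only on `n` and `A` such that if `γ` is an integer matrix with all entries of
`z⁻¹ γ z` bounded by `A` having a nonzero entry in its lower-left `m × (n-m)` block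
(1-based: some `γ i j ≠ 0` with `i ≥ n-m+1` and `j ≤ n-m`), then `y m ≤ C`. -/
theorem stmt_5 (n : ℕ) (hn : 2 ≤ n) (A : ℝ) (hA : 0 < A) :
    ∃ C : ℝ, 0 < C ∧
      ∀ (x : Matrix (Fin n) (Fin n) ℝ),
        (∀ i, x i i = 1) → (∀ i j : Fin n, j < i → x i j = 0) →
        (∀ i j : Fin n, i < j → |x i j| ≤ 1 / 2) →
      ∀ (y : ℕ → ℝ), (∀ l, 1 ≤ l → l ≤ n - 1 → 0 < y l) →
        (∀ l, 1 ≤ l → l ≤ n - 1 → Real.sqrt 3 / 2 ≤ y l) →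
      ∀ (γ : Matrix (Fin n) (Fin n) ℤ),
        (∀ i j : Fin n,
          |((zmat n x y)⁻¹ * (γ.map (Int.cast : ℤ → ℝ)) * zmat n x y) i j| ≤ A) →
        ∀ m : ℕ, 1 ≤ m → m ≤ n - 1 →
        ∀ i j : Fin n, n - m ≤ (i : ℕ) → (j : ℕ) + 1 ≤ n - m → γ i j ≠ 0 →
          y m ≤ C := by
  refine ⟨n * A * 2 ^ n, by positivity, ?_⟩
  intro x hdiag hlower hupper y hpos hy γ hW m hm hmn i j₀ hi hj₀ hγ₀
  have hhalf : ∀ l, 1 ≤ l → l ≤ n - 1 → 1 / 2 ≤ y l := fun l h₁ h₂ => by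
    have : (1 : ℝ) ≤ Real.sqrt 3 := Real.one_le_sqrt.mpr (by norm_num)
    linarith [hy l h₁ h₂]
  obtain ⟨j, hγ, hmin⟩ := WellFounded.has_min (wellFounded_lt (α := Fin n))
    {k | γ i k ≠ 0} ⟨j₀, hγ₀⟩
  have hj : (j : ℕ) + 1 ≤ n - m := by
    have : j ≤ j₀ := not_lt.mp (hmin j₀ hγ₀)
    rw [Fin.le_def] at this
    lia
  have hzero : ∀ k < j, γ.map (Int.cast : ℤ → ℝ) i k = 0 := fun k hk => by
    have : γ i k = 0 := by
      by_contra h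
      exact hmin k h hk
    simp [this]
  set W := (zmat n x y)⁻¹ * (γ.map (Int.cast : ℤ → ℝ)) * zmat n x y with hWdef
  have hconj : zmat n x y * W = γ.map (Int.cast : ℤ → ℝ) * zmat n x y := by
    rw [hWdef, Matrix.mul_assoc, Matrix.mul_nonsing_inv_cancel_left _ _
      (isUnit_det_zmat hdiag hlower hpos)]
  have hentry : ∑ a, x i a * tvec n y a * W a j = (γ i j : ℝ) * tvec n y j := by
    have h := congrFun (congrFun hconj i) j
    rw [Matrix.mul_apply] at h
    simp only [zmat, Matrix.mul_diagonal] at h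
    rw [h, ← Matrix.mul_assoc, Matrix.mul_diagonal,
      mul_apply_of_unipotent hdiag hlower hzero, Matrix.map_apply]
  have htj := tvec_pos hpos j
  have hym := hpos m hm hmn
  have hterm : ∀ a, |x i a * tvec n y a * W a j| * y m ≤ A * (2 ^ n * tvec n y j) := fun a => by
    rcases lt_or_ge a i with h | h
    · rw [hlower i a h]
      simp only [zero_mul, abs_zero]
      positivity
    · have hx : |x i a| ≤ 1 := by
        rcases h.eq_or_lt with rfl | h
        · simp [hdiag]
        · linarith [hupper i a h]
      have hta := tvec_pos hpos a
      have hle := tvec_mul_le hhalf hm (a := a) (hi.trans h) hj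
      calc |x i a * tvec n y a * W a j| * y m
          = |x i a| * |W a j| * (tvec n y a * y m) := by
            rw [abs_mul, abs_mul, abs_of_pos hta]
            ring
        _ ≤ 1 * A * (2 ^ n * tvec n y j) := by
            gcongr
            exact hW a j
        _ = A * (2 ^ n * tvec n y j) := by rw [one_mul]
  have hone : (1 : ℝ) ≤ |(γ i j : ℝ)| := by
    exact_mod_cast Int.one_le_abs hγ
  refine le_of_mul_le_mul_right ?_ htj
  calc y m * tvec n y j ≤ |(γ i j : ℝ)| * (y m * tvec n y j) :=
        le_mul_of_one_le_left (by positivity) hone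
    _ = |∑ a, x i a * tvec n y a * W a j| * y m := by
        rw [hentry, abs_mul, abs_of_pos htj]
        ring
    _ ≤ (∑ a, |x i a * tvec n y a * W a j|) * y m := by
        gcongr
        exact Finset.abs_sum_le_sum_abs _ _
    _ ≤ ∑ _a : Fin n, A * (2 ^ n * tvec n y j) := by
        rw [Finset.sum_mul]
        exact Finset.sum_le_sum fun a _ => hterm a
    _ = n * A * 2 ^ n * tvec n y j := by
        rw [Finset.sum_const, Finset.card_univ, Fintype.card_fin, nsmul_eq_mul]
        ring
end

section
/- Let n ≥ 2 be an integer and let y_1, …, y_{n−1} be positive real numbers. Then max_{1 ≤ j ≤ n−1} max( ∏_{i=1}^{j} y_i^{j−i+1}, ∏_{i=1}^{j} y_{n−i}^{j−i+1} )^{2/(j(j+1))} ≥ ( ∏_{i=1}^{n−1} y_i )^{1/(n−1)}. -/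
/-- The two weighted products of full length multiply to a power of the plain product. -/
theorem prod_pow_mul_prod_reflect_pow {M : Type*} [CommMonoid M] (m : ℕ) (y : ℕ → M) :
    (∏ i ∈ Finset.Icc 1 m, y i ^ (m - i + 1)) *
        (∏ i ∈ Finset.Icc 1 m, y (m + 1 - i) ^ (m - i + 1)) =
      (∏ i ∈ Finset.Icc 1 m, y i) ^ (m + 1) := by
  have h : ∏ i ∈ Finset.Icc 1 m, y (m + 1 - i) ^ (m - i + 1) =
      ∏ i ∈ Finset.Icc 1 m, y i ^ i := by
    refine Finset.prod_nbij' (fun i => m + 1 - i) (fun i => m + 1 - i) ?_ ?_ ?_ ?_ ?_ <;>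
      intro i hi <;> rw [Finset.mem_Icc] at hi
    · rw [Finset.mem_Icc]; omega
    · rw [Finset.mem_Icc]; omega
    · omega
    · omega
    · congr 1; omega
  rw [h, ← Finset.prod_mul_distrib, ← Finset.prod_pow]
  refine Finset.prod_congr rfl fun i hi => ?_
  rw [Finset.mem_Icc] at hi
  rw [← pow_add]
  congr 1
  omega

/-- For `n ≥ 2` and positive reals `y 1, …, y (n-1)`,
`max_{1 ≤ j ≤ n-1} max(∏_{i=1}^j (y i)^(j-i+1), ∏_{i=1}^j (y (n-i))^(j-i+1))^(2/(j(j+1)))`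
is at least `(∏_{i=1}^{n-1} y i)^(1/(n-1))`. -/
theorem stmt_13 (n : ℕ) (hn : 2 ≤ n) (y : ℕ → ℝ)
    (hy : ∀ i ∈ Finset.Icc 1 (n - 1), 0 < y i) :
    (∏ i ∈ Finset.Icc 1 (n - 1), y i) ^ ((1 : ℝ) / (n - 1)) ≤
      (Finset.Icc 1 (n - 1)).sup' (Finset.nonempty_Icc.2 (by omega))
        (fun j => (max (∏ i ∈ Finset.Icc 1 j, y i ^ (j - i + 1))
            (∏ i ∈ Finset.Icc 1 j, y (n - i) ^ (j - i + 1))) ^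
          ((2 : ℝ) / (j * (j + 1)))) := by
  obtain ⟨m, rfl⟩ : ∃ m, n = m + 1 := ⟨n - 1, by omega⟩
  simp only [Nat.add_sub_cancel] at hy ⊢
  have hm : 1 ≤ m := by omega
  have hm0 : (0 : ℝ) < m := by exact_mod_cast hm
  refine le_trans ?_ (Finset.le_sup' _ (Finset.mem_Icc.2 ⟨hm, le_rfl⟩))
  have hkey := prod_pow_mul_prod_reflect_pow m y
  have hA : 0 < ∏ i ∈ Finset.Icc 1 m, y i ^ (m - i + 1) :=
    Finset.prod_pos fun i hi => pow_pos (hy i hi) _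
  have hB : 0 < ∏ i ∈ Finset.Icc 1 m, y (m + 1 - i) ^ (m - i + 1) :=
    Finset.prod_pos fun i hi => pow_pos (hy _ (by rw [Finset.mem_Icc] at hi ⊢; omega)) _
  have hP : 0 < ∏ i ∈ Finset.Icc 1 m, y i := Finset.prod_pos hy
  set A := ∏ i ∈ Finset.Icc 1 m, y i ^ (m - i + 1)
  set B := ∏ i ∈ Finset.Icc 1 m, y (m + 1 - i) ^ (m - i + 1)
  set P := ∏ i ∈ Finset.Icc 1 m, y i
  have hM : 0 < max A B := lt_max_of_lt_left hA
  have hle : P ^ (m + 1) ≤ max A B ^ 2 := by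
    rw [← hkey, sq]
    exact mul_le_mul (le_max_left _ _) (le_max_right _ _) hB.le hM.le
  calc P ^ ((1 : ℝ) / ((m + 1 : ℕ) - 1))
      = (P ^ (m + 1)) ^ ((1 : ℝ) / (m * (m + 1))) := by
        rw [← Real.rpow_natCast_mul hP.le]
        congr 1
        push_cast
        rw [add_sub_cancel_right]
        field_simp
    _ ≤ (max A B ^ 2) ^ ((1 : ℝ) / (m * (m + 1))) :=
        Real.rpow_le_rpow (by positivity) hle (by positivity)
    _ = max A B ^ ((2 : ℝ) / (m * (m + 1))) := by
        rw [← Real.rpow_natCast_mul hM.le]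
        congr 1
        push_cast
        ring
end
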